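/- If q is a prime power with q ≡ 9 (mod 16), then there exists a skew Hadamard difference family with four blocks in (F_q,+), i.e., four skew subsets of F_q of size (q−1)/2 forming a difference family with parameters (q, (q−1)/2, q−3). -/

import Mathlib

open Finset
open scoped Classical

/-- A subset `B` of a finite additive abelian group is *skew* if
`B ∩ (-B) = ∅` and `B ∪ (-B) = G \ {0}`. -/
def IsSkewSet {G : Type} [AddCommGroup G] [Fintype G] (B : Finset G) : Prop :=
  B ∩ B.image (fun x => -x) = ∅ ∧ B ∪ B.image (fun x => -x) = Finset.univ \ {0}

/-- `B` is a difference family with block size `k` and index `lam`. -/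
def IsDiffFamily {G : Type} [AddCommGroup G] [Fintype G] {ℓ : ℕ}
    (B : Fin ℓ → Finset G) (k lam : ℕ) : Prop :=
  (∀ i, (B i).card = k) ∧
  ∀ g : G, g ≠ 0 →
    (∑ i, (((B i) ×ˢ (B i)).filter (fun p => p.1 ≠ p.2 ∧ p.1 - p.2 = g)).card) = lam


/-- The set where an odd function with values `±1` off zero takes the value `1` is skew. -/
theorem isSkewSet_filter_eq_one {G : Type} [AddCommGroup G] [Fintype G] {f : G → ℤ}
    (h0 : f 0 = 0) (hodd : ∀ x, f (-x) = -f x) (hval : ∀ x, x ≠ 0 → f x = 1 ∨ f x = -1) :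
    IsSkewSet (univ.filter fun x => f x = 1) := by
  have key : ∀ x, x ∈ (univ.filter fun x => f x = 1).image (fun x => -x) ↔ f x = -1 := by
    intro x
    simp only [mem_image, mem_filter, mem_univ, true_and]
    constructor
    · rintro ⟨y, hy, rfl⟩
      rw [hodd, hy]
    · intro h
      exact ⟨-x, by rw [hodd, h]; norm_num, neg_neg x⟩
  constructor
  · ext x
    rw [mem_inter, key]
    simp only [mem_filter, mem_univ, true_and, notMem_empty, iff_false]
    omega
  · ext x
    rw [mem_union, key]
    simp only [mem_filter, mem_univ, true_and, mem_sdiff, mem_singleton]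
    refine ⟨?_, hval x⟩
    rintro h rfl
    omega

theorem two_mul_indicator_eq_one {G : Type} [AddCommGroup G] {f : G → ℤ}
    (h0 : f 0 = 0) (hval : ∀ x, x ≠ 0 → f x = 1 ∨ f x = -1) (x : G) :
    2 * (if f x = 1 then (1 : ℤ) else 0) = 1 - (if x = 0 then 1 else 0) + f x := by
  by_cases hx : x = 0
  · simp [hx, h0]
  · rcases hval x hx with h | h <;> simp [h, hx]

theorem sum_eq_zero_of_odd {G : Type} [AddCommGroup G] [Fintype G] {f : G → ℤ}
    (hodd : ∀ x, f (-x) = -f x) : ∑ x, f x = 0 := by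
  have h : ∑ x, f (-x) = ∑ x, f x := Equiv.sum_comp (Equiv.neg G) f
  simp only [hodd, sum_neg_distrib] at h
  omega

theorem two_mul_card_filter_eq_one {G : Type} [AddCommGroup G] [Fintype G] {f : G → ℤ}
    (h0 : f 0 = 0) (hodd : ∀ x, f (-x) = -f x) (hval : ∀ x, x ≠ 0 → f x = 1 ∨ f x = -1) :
    2 * ((univ.filter fun x => f x = 1).card : ℤ) = Fintype.card G - 1 := by
  rw [card_filter]
  push_cast
  rw [mul_sum, sum_congr rfl fun x _ => two_mul_indicator_eq_one h0 hval x,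
    sum_add_distrib, sum_sub_distrib, sum_eq_zero_of_odd hodd]
  simp

/-- The number of representations of `d ≠ 0` as a difference in the set `{f = 1}`, in terms of
the autocorrelation of `f` at `d`. -/
theorem four_mul_card_differences {G : Type} [AddCommGroup G] [Fintype G] {f : G → ℤ}
    (h0 : f 0 = 0) (hodd : ∀ x, f (-x) = -f x) (hval : ∀ x, x ≠ 0 → f x = 1 ∨ f x = -1)
    {d : G} (hd : d ≠ 0) :
    4 * ((((univ.filter fun x => f x = 1) ×ˢ (univ.filter fun x => f x = 1)).filter
      (fun p => p.1 ≠ p.2 ∧ p.1 - p.2 = d)).card : ℤ)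
      = Fintype.card G - 2 + ∑ x, f (x + d) * f x := by
  have hcard : (((univ.filter fun x => f x = 1) ×ˢ (univ.filter fun x => f x = 1)).filter
      (fun p => p.1 ≠ p.2 ∧ p.1 - p.2 = d)).card
      = (univ.filter fun x => f (x + d) = 1 ∧ f x = 1).card := by
    refine card_nbij' (fun p => p.2) (fun x => (x + d, x)) ?_ ?_ ?_ ?_
    · rintro ⟨x, y⟩ h
      simp only [coe_filter, mem_product, mem_filter, mem_univ, true_and,
        Set.mem_ofPred_eq] at h ⊢
      obtain ⟨⟨hx, hy⟩, -, rfl⟩ := h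
      exact ⟨by simpa using hx, hy⟩
    · intro x h
      simp only [coe_filter, mem_product, mem_filter, mem_univ, true_and,
        Set.mem_ofPred_eq] at h ⊢
      exact ⟨h, by simpa using hd, by simp⟩
    · rintro ⟨x, y⟩ h
      simp only [coe_filter, mem_product, mem_filter, mem_univ, true_and,
        Set.mem_ofPred_eq] at h
      obtain ⟨-, -, rfl⟩ := h
      simp
    · intro x _
      rfl
  have hterm : ∀ x, 4 * (if f (x + d) = 1 ∧ f x = 1 then (1 : ℤ) else 0)
      = 1 - (if x = -d then 1 else 0) - (if x = 0 then 1 else 0) + f (x + d) + f x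
        - (if x = 0 then f d else 0) - (if x = -d then f (-d) else 0) + f (x + d) * f x := by
    intro x
    have h1 := two_mul_indicator_eq_one h0 hval (x + d)
    have h2 := two_mul_indicator_eq_one h0 hval x
    have h3 : (if f (x + d) = 1 ∧ f x = 1 then (1 : ℤ) else 0)
        = (if f (x + d) = 1 then 1 else 0) * (if f x = 1 then 1 else 0) := by
      by_cases h : f x = 1 <;> simp only [h, and_true, and_false, if_true, if_false, mul_one,
        mul_zero]
    have h4 : 4 * (if f (x + d) = 1 ∧ f x = 1 then (1 : ℤ) else 0)
        = (1 - (if x + d = 0 then 1 else 0) + f (x + d)) * (1 - (if x = 0 then 1 else 0) + f x) := by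
      rw [← h1, ← h2, h3]
      ring
    rw [h4]
    simp only [← eq_neg_iff_add_eq_zero]
    by_cases hx : x = 0
    · subst hx
      have : (0 : G) ≠ -d := fun h => hd (by simpa using h.symm)
      simp [this, h0]
    · by_cases hy : x = -d
      · subst hy
        simp [hd, h0]
      · simp only [hx, hy, if_false]
        ring
  have hshift : ∑ x, f (x + d) = ∑ x, f x := Equiv.sum_comp (Equiv.addRight d) f
  rw [hcard, card_filter]
  push_cast
  rw [mul_sum, sum_congr rfl fun x _ => hterm x]
  simp only [sum_add_distrib, sum_sub_distrib, hshift, sum_eq_zero_of_odd hodd, sum_ite_eq',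
    mem_univ, if_true, hodd d]
  simp
  ring

/-- In a finite field of order `9` modulo `16` the discrete logarithm modulo `8` sends `-1`
to `4`. -/
theorem exists_log_mod_eight {F : Type} [Field F] [Fintype F] (hF : Fintype.card F % 16 = 9) :
    ∃ L : F → ZMod 8, (∀ x y, x ≠ 0 → y ≠ 0 → L (x * y) = L x + L y) ∧ L (-1) = 4 := by
  have hn : Nat.card Fˣ % 16 = 8 := by
    rw [Nat.card_eq_fintype_card, Fintype.card_units]
    omega
  have h8 : 8 ∣ Nat.card Fˣ := by omega
  have : NeZero (Nat.card Fˣ) := ⟨by omega⟩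
  let e : Multiplicative (ZMod (Nat.card Fˣ)) ≃* Fˣ := zmodCyclicMulEquiv inferInstance
  let l : Fˣ → ZMod (Nat.card Fˣ) := fun u => (e.symm u).toAdd
  have hl : ∀ u v, l (u * v) = l u + l v := fun u v => by simp [l]
  have h2 : (2 : F) ≠ 0 := by
    intro h
    rcases eq_or_ne (ringChar F) 2 with hc | hc
    · have := FiniteField.even_card_of_char_two hc
      omega
    · exact Ring.two_ne_zero hc h
  have hne : l (-1) ≠ 0 := by
    intro h
    have h1 : e.symm (-1) = 1 := h
    have h3 : (-1 : Fˣ) = 1 := by simpa using h1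
    have h4 : (-1 : F) = 1 := by simpa using congrArg Units.val h3
    exact h2 (by linear_combination -h4)
  have hadd : l (-1) + l (-1) = 0 := by
    rw [← hl]
    simp [l]
  have hval : (l (-1)).val % 8 = 4 := by
    have hlt := (l (-1)).val_lt
    have hpos : (l (-1)).val ≠ 0 := by simpa [ZMod.val_eq_zero] using hne
    have hdvd : Nat.card Fˣ ∣ (l (-1)).val + (l (-1)).val := by
      rw [← ZMod.natCast_eq_zero_iff]
      simpa using hadd
    obtain ⟨c, hc⟩ := hdvd
    have hc1 : c = 1 := by
      have : c < 2 := by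
        by_contra! h
        nlinarith
      interval_cases c <;> omega
    subst hc1
    omega
  let φ := ZMod.castHom h8 (ZMod 8)
  refine ⟨fun x => if hx : x = 0 then 0 else φ (l (Units.mk0 x hx)), ?_, ?_⟩
  · intro x y hx hy
    simp only [hx, hy, mul_ne_zero hx hy, dif_neg, not_false_eq_true, ← map_add, ← hl]
    rw [Units.mk0_mul]
  · have hm : Units.mk0 (-1 : F) (neg_ne_zero.2 one_ne_zero) = -1 := by
      ext
      simp
    simp only [neg_eq_zero, one_ne_zero, dif_neg, not_false_eq_true, hm]
    rw [← ZMod.natCast_zmod_val (l (-1)), map_natCast, ← ZMod.natCast_mod, hval]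
    rfl

/-- The rows of a Hadamard matrix of order `4`, extended to negacyclic sequences on `ZMod 8`. -/
def negacyclicHadamard (i : Fin 4) (r : ZMod 8) : ℤ :=
  (!![1, 1, 1, 1, -1, -1, -1, -1;
     1, -1, 1, -1, -1, 1, -1, 1;
     1, 1, -1, -1, -1, -1, 1, 1;
     1, -1, -1, 1, -1, 1, 1, -1] : Matrix (Fin 4) (Fin 8) ℤ) i r

/-- The common correlation function of the columns of `negacyclicHadamard`, divided by `4`. -/
def negacyclicDelta (r : ZMod 8) : ℤ :=
  (![1, 0, 0, 0, -1, 0, 0, 0] : Fin 8 → ℤ) r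

theorem negacyclicHadamard_eq (i : Fin 4) (r : ZMod 8) :
    negacyclicHadamard i r = 1 ∨ negacyclicHadamard i r = -1 := by
  revert i r
  decide

theorem negacyclicHadamard_four_add (i : Fin 4) (r : ZMod 8) :
    negacyclicHadamard i (4 + r) = -negacyclicHadamard i r := by
  revert i r
  decide

theorem negacyclicDelta_four_add (r : ZMod 8) :
    negacyclicDelta (4 + r) = -negacyclicDelta r := by
  revert r
  decide

theorem sum_negacyclicHadamard_mul (r s : ZMod 8) :
    ∑ i, negacyclicHadamard i (r + s) * negacyclicHadamard i s = 4 * negacyclicDelta r := by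
  revert r s
  decide

/-- The autocorrelations of the four lifted sequences sum to `-4` at every nonzero shift. -/
theorem sum_autocorrelation_eq {F : Type} [Field F] [Fintype F] {L : F → ZMod 8}
    (hL : ∀ x y, x ≠ 0 → y ≠ 0 → L (x * y) = L x + L y) (hneg : L (-1) = 4)
    {d : F} (hd : d ≠ 0) :
    ∑ i, ∑ x, (if x + d = 0 then 0 else negacyclicHadamard i (L (x + d))) *
      (if x = 0 then 0 else negacyclicHadamard i (L x)) = -4 := by
  let h : F → ℤ := fun z => if z = 0 then 0 else negacyclicDelta (L z)
  have hL1 : L 1 = 0 := by simpa using hL 1 1 one_ne_zero one_ne_zero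
  have hodd : ∀ z, h (-z) = -h z := by
    intro z
    by_cases hz : z = 0
    · simp [h, hz]
    · have := hL (-1) z (by simp) hz
      rw [neg_one_mul, hneg] at this
      simp [h, hz, this, negacyclicDelta_four_add]
  have h1 : h 1 = 1 := by
    simp only [h, one_ne_zero, if_false, hL1]
    rfl
  have hterm : ∀ x, ∑ i, (if x + d = 0 then 0 else negacyclicHadamard i (L (x + d))) *
      (if x = 0 then 0 else negacyclicHadamard i (L x))
      = 4 * (h (1 + d * x⁻¹) - if x = 0 then 1 else 0) := by
    intro x
    by_cases hx : x = 0
    · simp [hx, h1]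
    · have hz : (1 + d * x⁻¹) * x = x + d := by field_simp
      by_cases hxd : x + d = 0
      · have hz0 : 1 + d * x⁻¹ = 0 := by
          rw [hxd] at hz
          exact (mul_eq_zero.1 hz).resolve_right hx
        simp [hxd, hx, hz0, h]
      · have hz0 : 1 + d * x⁻¹ ≠ 0 := by
          intro h0
          rw [h0, zero_mul] at hz
          exact hxd hz.symm
        simp only [hx, hz0, h, if_false, ← hz, hL _ _ hz0 hx, mul_eq_zero, or_self,
          sum_negacyclicHadamard_mul, sub_zero]
  have hsum : ∑ x, h (1 + d * x⁻¹) = 0 := by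
    rw [← sum_eq_zero_of_odd hodd]
    exact Equiv.sum_comp
      (((Equiv.inv F).trans (Equiv.mulLeft₀ d hd)).trans (Equiv.addLeft 1)) h
  rw [sum_comm, sum_congr rfl fun x _ => hterm x, ← mul_sum, sum_sub_distrib, hsum]
  simp

/-- (Wallis–Whiteman) If `q ≡ 9 (mod 16)` is a prime power, then there is a skew
Hadamard difference family with four blocks in `(F_q, +)`, with parameters
`(q, (q-1)/2, q-3)`. -/
theorem skew_hadamard_four_blocks (q : ℕ) (hq : IsPrimePow q) (hmod : q % 16 = 9)
    (F : Type) [Field F] [Fintype F] (hF : Fintype.card F = q) :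
    ∃ B : Fin 4 → Finset F,
      IsDiffFamily B ((q - 1) / 2) (q - 3) ∧ ∀ i, IsSkewSet (B i) := by
  obtain ⟨L, hL, hneg⟩ := exists_log_mod_eight (F := F) (by omega)
  let f : Fin 4 → F → ℤ := fun i x => if x = 0 then 0 else negacyclicHadamard i (L x)
  have h0 : ∀ i, f i 0 = 0 := fun i => if_pos rfl
  have hval : ∀ i x, x ≠ 0 → f i x = 1 ∨ f i x = -1 := by
    intro i x hx
    simpa only [f, hx, if_false] using negacyclicHadamard_eq i (L x)
  have hodd : ∀ i x, f i (-x) = -f i x := by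
    intro i x
    by_cases hx : x = 0
    · simp [hx, h0]
    · have := hL (-1) x (by simp) hx
      rw [neg_one_mul, hneg] at this
      simp [f, hx, this, negacyclicHadamard_four_add]
  refine ⟨fun i => univ.filter fun x => f i x = 1, ⟨fun i => ?_, fun d hd => ?_⟩,
    fun i => isSkewSet_filter_eq_one (h0 i) (hodd i) (hval i)⟩
  · have := two_mul_card_filter_eq_one (h0 i) (hodd i) (hval i)
    rw [hF] at this
    beta_reduce
    omega
  · have hcorr : ∑ i, ∑ x, f i (x + d) * f i x = -4 := sum_autocorrelation_eq hL hneg hd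
    have hcount := sum_congr (rfl : (univ : Finset (Fin 4)) = univ) fun i _ =>
      four_mul_card_differences (h0 i) (hodd i) (hval i) hd
    rw [← mul_sum, sum_add_distrib, hcorr, hF, sum_const, card_univ, Fintype.card_fin,
      nsmul_eq_mul, ← Nat.cast_sum] at hcount
    beta_reduce
    omega
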